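/- arXiv:2503.00273 — 2 statements merged into one kernel-verified Lean document; each statement's English description precedes it below -/
import Mathlib

section
/- For every ε ∈ (0,1) there exists a constant c > 0 such that for all integers n ≥ 2, all Δ ∈ (0, 1-ε], and all horizons t ∈ ℕ with t ≤ n/Δ², there exists an interactive algorithm whose success probability satisfies P(a_{t+1} = a*) ≥ c·(1 + tΔ²)/n; in particular p*_t ≥ c·(1 + tΔ²)/n. -/
open scoped BigOperators

noncomputable section

/-- Probability that pulling arm `a` yields reward `r : Bool` (with `true` = reward 1),
when the best arm is `astar`: `Bernoulli ((1+Δ)/2)` if `a = astar`, else `Bernoulli ((1-Δ)/2)`. -/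
def rewP (n : ℕ) (Δ : ℝ) (astar a : Fin n) (r : Bool) : ℝ :=
  if r then (if a = astar then (1 + Δ) / 2 else (1 - Δ) / 2)
  else 1 - (if a = astar then (1 + Δ) / 2 else (1 - Δ) / 2)

/-- An interactive algorithm: for every history (recorded with the most recent pull first),
a probability distribution over the `n` arms used to draw the next pull. -/
def IsAlg (n : ℕ) (alg : List (Fin n × Bool) → Fin n → ℝ) : Prop :=
  ∀ h : List (Fin n × Bool), (∀ a, 0 ≤ alg h a) ∧ (∑ a : Fin n, alg h a) = 1

/-- Probability, conditionally on the best arm `astar`, of observing a given history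
(recorded with the most recent pull first) when running the algorithm `alg`. -/
def histP (n : ℕ) (alg : List (Fin n × Bool) → Fin n → ℝ) (Δ : ℝ) (astar : Fin n) :
    List (Fin n × Bool) → ℝ
  | [] => 1
  | (a, r) :: prev => histP n alg Δ astar prev * alg prev a * rewP n Δ astar a r

/-- The reversed history (most recent pull first) associated with a tuple of `t` pulls. -/
def hist {n t : ℕ} (h : Fin t → Fin n × Bool) : List (Fin n × Bool) :=
  (List.ofFn h).reverse

/-- Success probability `P(a_{t+1} = a*)` of an interactive algorithm after `t` rounds,
under the uniform prior on the best arm. -/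
def succProb (n t : ℕ) (alg : List (Fin n × Bool) → Fin n → ℝ) (Δ : ℝ) : ℝ :=
  ((n : ℝ))⁻¹ * ∑ astar : Fin n, ∑ h : Fin t → Fin n × Bool,
    histP n alg Δ astar (hist h) * alg (hist h) astar

/-- Mutual information (in nats) `I(a*; H_t)` accumulated by an interactive algorithm. -/
def mutualInfo (n t : ℕ) (alg : List (Fin n × Bool) → Fin n → ℝ) (Δ : ℝ) : ℝ :=
  ∑ astar : Fin n, ∑ h : Fin t → Fin n × Bool,
    ((n : ℝ))⁻¹ * histP n alg Δ astar (hist h) *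
      Real.log (histP n alg Δ astar (hist h) /
        (((n : ℝ))⁻¹ * ∑ b : Fin n, histP n alg Δ b (hist h)))

/-- Optimal success probability `p*_t`. -/
def pStar (n t : ℕ) (Δ : ℝ) : ℝ :=
  sSup {x : ℝ | ∃ alg, IsAlg n alg ∧ x = succProb n t alg Δ}

/-- Optimal mutual information `I*_t`. -/
def IStar (n t : ℕ) (Δ : ℝ) : ℝ :=
  sSup {x : ℝ | ∃ alg, IsAlg n alg ∧ x = mutualInfo n t alg Δ}

open Finset

section Transition

variable {n : ℕ} {alg : List (Fin n × Bool) → Fin n → ℝ} {Δ : ℝ}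

lemma rewP_nonneg (h0 : 0 ≤ Δ) (h1 : Δ ≤ 1) (astar a : Fin n) (r : Bool) :
    0 ≤ rewP n Δ astar a r := by
  unfold rewP
  split_ifs <;> linarith

lemma histP_nonneg (halg : IsAlg n alg) (h0 : 0 ≤ Δ) (h1 : Δ ≤ 1) (astar : Fin n)
    (l : List (Fin n × Bool)) : 0 ≤ histP n alg Δ astar l := by
  induction l with
  | nil => exact zero_le_one
  | cons x l ih =>
    exact mul_nonneg (mul_nonneg ih ((halg l).1 _)) (rewP_nonneg h0 h1 _ _ _)

/-- Expectation of `f H_t` given the best arm `astar`. -/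
def histExp (alg : List (Fin n × Bool) → Fin n → ℝ) (Δ : ℝ) (astar : Fin n) (t : ℕ)
    (f : List (Fin n × Bool) → ℝ) : ℝ :=
  ∑ h : Fin t → Fin n × Bool, histP n alg Δ astar (hist h) * f (hist h)

/-- Conditional expectation of `f H_{s+1}` given `H_s = l` and the best arm `astar`. -/
def stepExp (alg : List (Fin n × Bool) → Fin n → ℝ) (Δ : ℝ) (astar : Fin n)
    (f : List (Fin n × Bool) → ℝ) (l : List (Fin n × Bool)) : ℝ :=
  ∑ a : Fin n, alg l a * ∑ r : Bool, rewP n Δ astar a r * f ((a, r) :: l)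

lemma histExp_zero (astar : Fin n) (f : List (Fin n × Bool) → ℝ) :
    histExp alg Δ astar 0 f = f [] := by
  simp [histExp, hist, histP]

lemma hist_snoc {t : ℕ} (x : Fin n × Bool) (g : Fin t → Fin n × Bool) :
    hist (Fin.snoc g x : Fin (t + 1) → Fin n × Bool) = x :: hist g := by
  rw [hist, hist, List.ofFn_succ', List.concat_eq_append, List.reverse_append]
  simp

lemma histExp_succ (astar : Fin n) (t : ℕ) (f : List (Fin n × Bool) → ℝ) :
    histExp alg Δ astar (t + 1) f = histExp alg Δ astar t (stepExp alg Δ astar f) := by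
  unfold histExp stepExp
  rw [← (Fin.snocEquiv fun _ : Fin (t + 1) => Fin n × Bool).sum_comp, Fintype.sum_prod_type_right]
  refine sum_congr rfl fun g _ => ?_
  rw [Fintype.sum_prod_type, mul_sum]
  refine sum_congr rfl fun a _ => ?_
  rw [mul_sum, mul_sum]
  refine sum_congr rfl fun r _ => ?_
  change histP n alg Δ astar (hist (Fin.snoc g (a, r))) * f (hist (Fin.snoc g (a, r))) = _
  rw [hist_snoc, histP]
  ring

lemma histExp_mono (halg : IsAlg n alg) (h0 : 0 ≤ Δ) (h1 : Δ ≤ 1) (astar : Fin n) (t : ℕ)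
    {f g : List (Fin n × Bool) → ℝ} (hfg : ∀ l, f l ≤ g l) :
    histExp alg Δ astar t f ≤ histExp alg Δ astar t g :=
  sum_le_sum fun _ _ => mul_le_mul_of_nonneg_left (hfg _) (histP_nonneg halg h0 h1 _ _)

lemma histExp_one (halg : IsAlg n alg) (astar : Fin n) (t : ℕ) :
    histExp alg Δ astar t (fun _ => 1) = 1 := by
  induction t with
  | zero => exact histExp_zero _ _
  | succ t ih =>
    have hstep : stepExp alg Δ astar (fun _ => 1) = fun _ => 1 := by
      funext l
      simp [stepExp, rewP, (halg l).2]
    rw [histExp_succ, hstep, ih]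

/-- A process `F` indexed by the remaining time that is a submartingale satisfies
`F t H_0 ≤ E[F 0 H_t]`. -/
lemma le_histExp_of_submartingale (halg : IsAlg n alg) (h0 : 0 ≤ Δ) (h1 : Δ ≤ 1)
    (astar : Fin n) (t : ℕ) (F : ℕ → List (Fin n × Bool) → ℝ)
    (hF : ∀ s < t, ∀ l, F (s + 1) l ≤ stepExp alg Δ astar (F s) l) :
    F t [] ≤ histExp alg Δ astar t (F 0) := by
  induction t generalizing F with
  | zero => rw [histExp_zero]
  | succ t ih =>
    rw [histExp_succ]
    exact (ih (fun s => F (s + 1)) fun s hs => hF (s + 1) (by omega)).trans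
      (histExp_mono halg h0 h1 _ _ (hF 0 (by omega)))

lemma succProb_eq (t : ℕ) :
    succProb n t alg Δ =
      (n : ℝ)⁻¹ * ∑ astar, histExp alg Δ astar t fun l => alg l astar := rfl

lemma succProb_le_one (halg : IsAlg n alg) (h0 : 0 ≤ Δ) (h1 : Δ ≤ 1) (t : ℕ) :
    succProb n t alg Δ ≤ 1 := by
  have key : ∑ astar, histExp alg Δ astar t (fun l => alg l astar) ≤ ∑ _astar : Fin n, (1 : ℝ) := by
    refine sum_le_sum fun astar _ => ?_
    rw [← histExp_one (Δ := Δ) halg astar t]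
    refine histExp_mono halg h0 h1 _ _ fun l => ?_
    rw [← (halg l).2]
    exact single_le_sum (fun a _ => (halg l).1 a) (mem_univ astar)
  rw [succProb_eq]
  refine (mul_le_mul_of_nonneg_left key (by positivity)).trans ?_
  simpa using inv_mul_le_one

lemma succProb_le_pStar (halg : IsAlg n alg) (h0 : 0 ≤ Δ) (h1 : Δ ≤ 1) (t : ℕ) :
    succProb n t alg Δ ≤ pStar n t Δ := by
  refine le_csSup ⟨1, ?_⟩ ⟨alg, halg, rfl⟩
  rintro _ ⟨alg', halg', rfl⟩
  exact succProb_le_one halg' h0 h1 t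

end Transition

/-- State `(i, y)` of sequential elimination: `i` arms have been discarded, and `y + 1` is the
current height of the reward walk of the arm under test, which is discarded at height `0`. -/
def elimStep (K : ℕ) : ℕ × ℕ → Bool → ℕ × ℕ
  | (i, y), true => (i, y + 1)
  | (i, 0), false => (i + 1, K)
  | (i, y + 1), false => (i, y)

/-- State of sequential elimination after a history. -/
def elimState {n : ℕ} (K : ℕ) : List (Fin n × Bool) → ℕ × ℕ
  | [] => (0, K)
  | x :: l => elimStep K (elimState K l) x.2

/-- Sequential elimination: test the arms one after the other, pulling each arm until its reward
walk started at height `K + 1` reaches `0`. -/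
def elimAlg (n K : ℕ) (l : List (Fin n × Bool)) (a : Fin n) : ℝ :=
  if a.val = (elimState K l).1 % n then 1 else 0

lemma elimAlg_eq_ite {n : ℕ} (hn : 0 < n) (K : ℕ) (l : List (Fin n × Bool)) (a : Fin n) :
    elimAlg n K l a = if a = ⟨(elimState K l).1 % n, Nat.mod_lt _ hn⟩ then 1 else 0 := by
  simp [elimAlg, Fin.ext_iff]

lemma isAlg_elimAlg {n : ℕ} (hn : 0 < n) (K : ℕ) : IsAlg n (elimAlg n K) := by
  refine fun l => ⟨fun a => ?_, ?_⟩
  · unfold elimAlg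
    split_ifs <;> norm_num
  · simp [elimAlg_eq_ite hn]

/-- Lower bound for the probability that sequential elimination tests the arm `m` after `s` more
pulls from a given state, when `m` is the best arm and the horizon is `T`. -/
def elimPotential (K : ℕ) (Δ T : ℝ) (m s : ℕ) (z : ℕ × ℕ) : ℝ :=
  if z.1 < m then
    (1 - ((1 - Δ) / (1 + Δ)) ^ (K + 1)) *
      (s - (z.2 + 1 + (m - 1 - z.1) * (K + 1)) / Δ) / T
  else if z.1 = m then 1 - ((1 - Δ) / (1 + Δ)) ^ (z.2 + 1)
  else 0

lemma stepExp_elimAlg {n : ℕ} (hn : 0 < n) (K : ℕ) (Δ : ℝ) (astar : Fin n) (φ : ℕ × ℕ → ℝ)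
    (l : List (Fin n × Bool)) {p : ℝ}
    (hp : p = if (elimState K l).1 % n = astar then (1 + Δ) / 2 else (1 - Δ) / 2) :
    stepExp (elimAlg n K) Δ astar (fun l => φ (elimState K l)) l =
      p * φ (elimStep K (elimState K l) true) +
        (1 - p) * φ (elimStep K (elimState K l) false) := by
  simp only [stepExp, elimAlg_eq_ite hn, ite_mul, one_mul, zero_mul, sum_ite_eq',
    mem_univ, if_true]
  simp [rewP, elimState, Fin.ext_iff, hp]

lemma ratio_nonneg {Δ : ℝ} (h0 : 0 < Δ) (h1 : Δ ≤ 1) : 0 ≤ (1 - Δ) / (1 + Δ) :=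
  div_nonneg (by linarith) (by linarith)

lemma ratio_le_one {Δ : ℝ} (h0 : 0 < Δ) : (1 - Δ) / (1 + Δ) ≤ 1 := by
  rw [div_le_one (by linarith)]
  linarith

lemma elimPotential_zero_le {n : ℕ} (K : ℕ) {Δ T : ℝ} (h0 : 0 < Δ) (h1 : Δ ≤ 1) (hT : 0 ≤ T)
    (astar : Fin n) (l : List (Fin n × Bool)) :
    elimPotential K Δ T astar 0 (elimState K l) ≤ elimAlg n K l astar := by
  have hnn : 0 ≤ elimAlg n K l astar := by
    unfold elimAlg
    split_ifs <;> norm_num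
  unfold elimPotential
  split_ifs with hlt heq
  · refine le_trans (div_nonpos_of_nonpos_of_nonneg ?_ hT) hnn
    refine mul_nonpos_of_nonneg_of_nonpos
      (sub_nonneg.2 (pow_le_one₀ (ratio_nonneg h0 h1) (ratio_le_one h0))) ?_
    have hm : ((elimState K l).1 : ℝ) + 1 ≤ (astar : ℕ) := by exact_mod_cast hlt
    have : 0 ≤ ((elimState K l).2 + 1 +
        (((astar : ℕ) : ℝ) - 1 - (elimState K l).1) * (K + 1)) / Δ :=
      div_nonneg (add_nonneg (by positivity) (mul_nonneg (by linarith) (by positivity))) h0.le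
    push_cast
    linarith
  · have : elimAlg n K l astar = 1 := by
      simp [elimAlg, heq, Nat.mod_eq_of_lt astar.isLt]
    rw [this]
    linarith [pow_nonneg (ratio_nonneg h0 h1) ((elimState K l).2 + 1)]
  · exact hnn

lemma elimPotential_step_of_lt (K : ℕ) {Δ T : ℝ} (h0 : 0 < Δ) (h1 : Δ ≤ 1) (m s : ℕ)
    (hs : (s : ℝ) < T) (z : ℕ × ℕ) (hz : z.1 < m) :
    elimPotential K Δ T m (s + 1) z ≤
      (1 - Δ) / 2 * elimPotential K Δ T m s (elimStep K z true) +
        (1 - (1 - Δ) / 2) * elimPotential K Δ T m s (elimStep K z false) := by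
  obtain ⟨i, y⟩ := z
  simp only at hz
  have hT : 0 < T := (Nat.cast_nonneg s).trans_lt hs
  have hq : 0 ≤ 1 - ((1 - Δ) / (1 + Δ)) ^ (K + 1) :=
    sub_nonneg.2 (pow_le_one₀ (ratio_nonneg h0 h1) (ratio_le_one h0))
  have hfalse : (1 - ((1 - Δ) / (1 + Δ)) ^ (K + 1)) *
      (s - (y + (m - 1 - i) * (K + 1)) / Δ) / T ≤
        elimPotential K Δ T m s (elimStep K (i, y) false) := by
    cases y with
    | zero =>
      rcases Nat.lt_or_ge (i + 1) m with him | him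
      · simp only [elimStep, elimPotential, him, if_true]
        apply le_of_eq
        push_cast
        ring
      · obtain rfl : m = i + 1 := by omega
        simp only [elimStep, elimPotential, lt_irrefl, if_true, if_false]
        rw [div_le_iff₀ hT]
        refine mul_le_mul_of_nonneg_left ?_ hq
        push_cast
        ring_nf
        exact hs.le
    | succ y =>
      simp only [elimStep, elimPotential, hz, if_true]
      push_cast
      exact le_rfl
  refine le_trans (le_of_eq ?_) (add_le_add_right
    (mul_le_mul_of_nonneg_left hfalse (by linarith : 0 ≤ 1 - (1 - Δ) / 2)) _)
  simp only [elimStep, elimPotential, hz, if_true]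
  push_cast
  field_simp
  ring

lemma elimPotential_step_of_eq (K : ℕ) {Δ T : ℝ} (h0 : 0 < Δ) (m s y : ℕ) :
    elimPotential K Δ T m (s + 1) (m, y) ≤
      (1 + Δ) / 2 * elimPotential K Δ T m s (elimStep K (m, y) true) +
        (1 - (1 + Δ) / 2) * elimPotential K Δ T m s (elimStep K (m, y) false) := by
  have hfalse : elimPotential K Δ T m s (elimStep K (m, y) false) =
      1 - ((1 - Δ) / (1 + Δ)) ^ y := by
    cases y <;> simp [elimStep, elimPotential]
  have hρ : (1 + Δ) * ((1 - Δ) / (1 + Δ)) = 1 - Δ := mul_div_cancel₀ _ (by linarith)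
  rw [hfalse]
  simp only [elimStep, elimPotential, lt_irrefl, if_true, if_false]
  generalize (1 - Δ) / (1 + Δ) = ρ at hρ
  apply le_of_eq
  rw [pow_succ, pow_succ]
  linear_combination (ρ ^ y * ρ / 2 - ρ ^ y / 2) * hρ

lemma elimPotential_step_of_gt (K : ℕ) (Δ T p : ℝ) (m s : ℕ) (z : ℕ × ℕ) (hz : m < z.1) :
    elimPotential K Δ T m (s + 1) z ≤
      p * elimPotential K Δ T m s (elimStep K z true) +
        (1 - p) * elimPotential K Δ T m s (elimStep K z false) := by
  have hzero : ∀ (s : ℕ) (z : ℕ × ℕ), m < z.1 → elimPotential K Δ T m s z = 0 := by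
    intro s z hz
    simp [elimPotential, hz.not_gt, hz.ne']
  obtain ⟨i, y⟩ := z
  simp only at hz
  rw [hzero _ _ hz, hzero, hzero]
  · simp
  · cases y <;> simp only [elimStep] <;> omega
  · exact hz

lemma elimPotential_le_histExp {n : ℕ} (K : ℕ) {Δ : ℝ} (h0 : 0 < Δ) (h1 : Δ ≤ 1)
    (astar : Fin n) (t : ℕ) :
    elimPotential K Δ t astar t (0, K) ≤
      histExp (elimAlg n K) Δ astar t fun l => elimAlg n K l astar := by
  have hn : 0 < n := astar.pos
  refine (le_histExp_of_submartingale (isAlg_elimAlg hn K) h0.le h1 astar t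
    (fun s l => elimPotential K Δ t astar s (elimState K l)) ?_).trans
    (histExp_mono (isAlg_elimAlg hn K) h0.le h1 astar t
      (elimPotential_zero_le K h0 h1 (Nat.cast_nonneg t) astar))
  intro s hs l
  rw [stepExp_elimAlg hn K Δ astar (elimPotential K Δ t astar s) l rfl]
  rcases lt_trichotomy (elimState K l).1 astar with hlt | heq | hgt
  · rw [if_neg (by rw [Nat.mod_eq_of_lt (hlt.trans astar.isLt)]; exact hlt.ne)]
    exact elimPotential_step_of_lt K h0 h1 astar s (by exact_mod_cast hs) _ hlt
  · rw [if_pos (by rw [heq, Nat.mod_eq_of_lt astar.isLt])]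
    have hz : elimState K l = ((astar : ℕ), (elimState K l).2) := Prod.ext heq rfl
    rw [hz]
    exact elimPotential_step_of_eq K h0 astar s _
  · exact elimPotential_step_of_gt K Δ t _ astar s _ hgt

lemma ratio_pow_le_half {Δ : ℝ} (h0 : 0 < Δ) (h1 : Δ ≤ 1) {k : ℕ} (hk : 1 ≤ k * Δ) :
    ((1 - Δ) / (1 + Δ)) ^ k ≤ 1 / 2 := by
  have hbern : 1 + k * Δ ≤ (1 + Δ) ^ k := one_add_mul_le_pow (by linarith) k
  rw [div_pow, div_le_iff₀ (by positivity)]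
  linarith [pow_le_one₀ (n := k) (by linarith : 0 ≤ 1 - Δ) (by linarith)]

lemma quarter_le_elimPotential {Δ : ℝ} (h0 : 0 < Δ) (h1 : Δ ≤ 1) (m t : ℕ)
    (hm : (m : ℝ) ≤ t * Δ ^ 2 / 4) :
    1 / 4 ≤ elimPotential ⌊1 / Δ⌋₊ Δ t m t (0, ⌊1 / Δ⌋₊) := by
  set K := ⌊1 / Δ⌋₊ with hK
  have hlow : 1 ≤ ((K + 1 : ℕ) : ℝ) * Δ := by
    have := Nat.lt_floor_add_one (1 / Δ)
    rw [div_lt_iff₀ h0] at this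
    push_cast
    exact this.le
  have hupp : ((K : ℝ) + 1) * Δ ≤ 2 := by
    have := Nat.floor_le (by positivity : 0 ≤ 1 / Δ)
    rw [← hK, le_div_iff₀ h0] at this
    linarith
  have hq := ratio_pow_le_half h0 h1 hlow
  unfold elimPotential
  rcases Nat.eq_zero_or_pos m with rfl | hpos
  · simp only [lt_irrefl, if_true, if_false]
    linarith
  · simp only [hpos, if_true]
    have hm1 : (1 : ℝ) ≤ m := by exact_mod_cast hpos
    have ht : (0 : ℝ) < t := by
      by_contra! hle
      have : (t : ℝ) * Δ ^ 2 ≤ 0 := mul_nonpos_of_nonpos_of_nonneg hle (by positivity)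
      linarith
    have htime : ((K : ℝ) + 1 + (m - 1 - (0 : ℕ)) * (K + 1)) / Δ ≤ t / 2 := by
      rw [div_le_iff₀ h0, ← mul_le_mul_iff_left₀ h0]
      calc ((K : ℝ) + 1 + (m - 1 - (0 : ℕ)) * (K + 1)) * Δ = m * ((K + 1) * Δ) := by
            push_cast
            ring
        _ ≤ m * 2 := by gcongr
        _ ≤ t / 2 * Δ * Δ := by linarith [hm, sq Δ]
    rw [le_div_iff₀ ht]
    calc (1 / 4 : ℝ) * t = 1 / 2 * (t / 2) := by ring
      _ ≤ _ := mul_le_mul (by linarith) (by linarith) (by positivity) (by linarith)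

lemma histExp_elimAlg_nonneg {n : ℕ} (K : ℕ) {Δ : ℝ} (h0 : 0 ≤ Δ) (h1 : Δ ≤ 1)
    (astar : Fin n) (t : ℕ) :
    0 ≤ histExp (elimAlg n K) Δ astar t fun l => elimAlg n K l astar :=
  sum_nonneg fun _ _ => mul_nonneg (histP_nonneg (isAlg_elimAlg astar.pos K) h0 h1 _ _)
    ((isAlg_elimAlg astar.pos K _).1 _)

lemma le_succProb_elimAlg {n : ℕ} (hn : 0 < n) {Δ : ℝ} (h0 : 0 < Δ) (h1 : Δ ≤ 1) (t : ℕ)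
    (ht : (t : ℝ) ≤ n / Δ ^ 2) :
    1 / 32 * (1 + t * Δ ^ 2) / n ≤ succProb n t (elimAlg n ⌊1 / Δ⌋₊) Δ := by
  have hn' : (0 : ℝ) < n := by exact_mod_cast hn
  rw [le_div_iff₀ (by positivity)] at ht
  set M := ⌊(t : ℝ) * Δ ^ 2 / 4⌋₊ with hM
  have hM_le : (M : ℝ) ≤ t * Δ ^ 2 / 4 := Nat.floor_le (by positivity)
  have hM_lt : (t : ℝ) * Δ ^ 2 / 4 < M + 1 := Nat.lt_floor_add_one _
  have hMn : M + 1 ≤ n := by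
    have : (M : ℝ) < n := by linarith
    exact_mod_cast this
  have hsum : ((M : ℝ) + 1) * (1 / 4) ≤
      ∑ astar, histExp (elimAlg n ⌊1 / Δ⌋₊) Δ astar t
        fun l => elimAlg n ⌊1 / Δ⌋₊ l astar := by
    calc ((M : ℝ) + 1) * (1 / 4) = ∑ _j : Fin (M + 1), (1 / 4 : ℝ) := by simp
      _ ≤ ∑ j : Fin (M + 1), histExp (elimAlg n ⌊1 / Δ⌋₊) Δ (Fin.castLEEmb hMn j) t
            fun l => elimAlg n ⌊1 / Δ⌋₊ l (Fin.castLEEmb hMn j) := by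
          refine sum_le_sum fun j _ => (quarter_le_elimPotential h0 h1 j t ?_).trans
            (elimPotential_le_histExp _ h0 h1 (Fin.castLEEmb hMn j) t)
          have : (j : ℝ) ≤ M := by exact_mod_cast Nat.lt_succ_iff.1 j.isLt
          linarith
      _ = ∑ astar ∈ univ.map (Fin.castLEEmb hMn), histExp (elimAlg n ⌊1 / Δ⌋₊) Δ astar t
            fun l => elimAlg n ⌊1 / Δ⌋₊ l astar := by rw [sum_map]
      _ ≤ _ := sum_le_sum_of_subset_of_nonneg (subset_univ _)
            fun astar _ _ => histExp_elimAlg_nonneg _ h0.le h1 astar t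
  rw [succProb_eq, div_eq_inv_mul]
  refine mul_le_mul_of_nonneg_left (le_trans ?_ hsum) (by positivity)
  have : (0 : ℝ) ≤ M := Nat.cast_nonneg M
  linarith

/-- Achievability for the success probability: for every `ε ∈ (0,1)` there is `c > 0` such that
for all `n ≥ 2`, `Δ ∈ (0, 1-ε]` and `t ≤ n/Δ²`, some interactive algorithm succeeds with
probability at least `c (1 + tΔ²)/n`; in particular `p*_t ≥ c (1 + tΔ²)/n`. -/
theorem bandit_success_achievability :
    ∀ ε : ℝ, ε ∈ Set.Ioo (0 : ℝ) 1 → ∃ c : ℝ, 0 < c ∧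
      ∀ n : ℕ, 2 ≤ n → ∀ Δ : ℝ, Δ ∈ Set.Ioc (0 : ℝ) (1 - ε) →
        ∀ t : ℕ, (t : ℝ) ≤ (n : ℝ) / Δ ^ 2 →
          (∃ alg, IsAlg n alg ∧
              c * (1 + t * Δ ^ 2) / n ≤ succProb n t alg Δ) ∧
            c * (1 + t * Δ ^ 2) / n ≤ pStar n t Δ := by
  intro ε hε
  refine ⟨1 / 32, by norm_num, fun n hn Δ hΔ t ht => ?_⟩
  have hn0 : 0 < n := by omega
  have h1 : Δ ≤ 1 := by linarith [hΔ.2, hε.1]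
  have key := le_succProb_elimAlg hn0 hΔ.1 h1 t ht
  have halg := isAlg_elimAlg hn0 ⌊1 / Δ⌋₊
  exact ⟨⟨_, halg, key⟩, key.trans (succProb_le_pStar halg hΔ.1.le h1 t)⟩
end
end

section
/- For every ε ∈ (0,1) there exists a constant C > 0 such that for all integers n ≥ 2, all Δ ∈ (0, 1-ε], and all horizons t ∈ ℕ with t ≤ n/Δ², the optimal success probability satisfies p*_t ≤ C·(1 + tΔ²)/n. -/
open scoped BigOperators

noncomputable section

/-- The weight of a history (most recent pull first) when pulling arm `a` yields reward `r`
with weight `w a r`. -/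
def trajP {n : ℕ} (alg : List (Fin n × Bool) → Fin n → ℝ) (w : Fin n → Bool → ℝ) :
    List (Fin n × Bool) → ℝ
  | [] => 1
  | (a, r) :: prev => trajP alg w prev * alg prev a * w a r

/-- The reward law of an arm that is not the best one. -/
def nullRew (n : ℕ) (Δ : ℝ) (_ : Fin n) (r : Bool) : ℝ :=
  if r then (1 - Δ) / 2 else (1 + Δ) / 2

/-- Log-likelihood ratio of a history between best arm `a` and no best arm. -/
def logLR {n : ℕ} (l : ℝ) (a : Fin n) : List (Fin n × Bool) → ℝ
  | [] => 0
  | (b, r) :: prev => logLR l a prev + if b = a then (if r then l else -l) else 0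

lemma histP_eq_trajP (n : ℕ) (alg : List (Fin n × Bool) → Fin n → ℝ) (Δ : ℝ) (a : Fin n)
    (h : List (Fin n × Bool)) : histP n alg Δ a h = trajP alg (rewP n Δ a) h := by
  induction h with
  | nil => rfl
  | cons x prev ih => rw [histP, trajP, ih]

lemma trajP_nonneg {n : ℕ} {alg : List (Fin n × Bool) → Fin n → ℝ} (halg : IsAlg n alg)
    {w : Fin n → Bool → ℝ} (hw : ∀ a r, 0 ≤ w a r) (h : List (Fin n × Bool)) :
    0 ≤ trajP alg w h := by
  induction h with
  | nil => exact zero_le_one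
  | cons x prev ih => exact mul_nonneg (mul_nonneg ih ((halg prev).1 _)) (hw _ _)

lemma sum_hist_succ {n t : ℕ} (F : List (Fin n × Bool) → ℝ) :
    ∑ h : Fin (t + 1) → Fin n × Bool, F (hist h) =
      ∑ h : Fin t → Fin n × Bool, ∑ a : Fin n, (F ((a, true) :: hist h) +
        F ((a, false) :: hist h)) := by
  rw [← (Fin.snocEquiv fun _ : Fin (t + 1) => Fin n × Bool).sum_comp, Fintype.sum_prod_type,
    Finset.sum_comm]
  refine Finset.sum_congr rfl fun h _ => ?_
  rw [Fintype.sum_prod_type]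
  refine Finset.sum_congr rfl fun a _ => ?_
  have hs (x : Fin n × Bool) :
      hist (Fin.snocEquiv (fun _ : Fin (t + 1) => Fin n × Bool) (x, h)) = x :: hist h := by
    simp [hist, Fin.snocEquiv, List.ofFn_succ', -List.ofFn_succ]
  simp [hs]

lemma sum_trajP {n : ℕ} {alg : List (Fin n × Bool) → Fin n → ℝ} (halg : IsAlg n alg)
    {w : Fin n → Bool → ℝ} (hw : ∀ a, w a true + w a false = 1) (t : ℕ) :
    ∑ h : Fin t → Fin n × Bool, trajP alg w (hist h) = 1 := by
  induction t with
  | zero => simp [hist, trajP]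
  | succ t ih =>
    rw [sum_hist_succ, ← ih]
    refine Finset.sum_congr rfl fun h _ => ?_
    simp only [trajP, ← mul_add, hw, mul_one]
    rw [← Finset.mul_sum, (halg _).2, mul_one]

lemma sum_logLR_cons {n : ℕ} (l : ℝ) (b : Fin n) (r : Bool) (prev : List (Fin n × Bool)) :
    ∑ a, logLR l a ((b, r) :: prev) = ∑ a, logLR l a prev + if r then l else -l := by
  simp [logLR, Finset.sum_add_distrib]

lemma sum_trajP_mul_sum_logLR {n : ℕ} {alg : List (Fin n × Bool) → Fin n → ℝ}
    (halg : IsAlg n alg) (Δ l : ℝ) (t : ℕ) :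
    ∑ h : Fin t → Fin n × Bool,
      trajP alg (nullRew n Δ) (hist h) * ∑ a, logLR l a (hist h) = -(t * (Δ * l)) := by
  induction t with
  | zero => simp [hist, logLR]
  | succ t ih =>
    rw [sum_hist_succ fun h => trajP alg (nullRew n Δ) h * ∑ a, logLR l a h]
    have hstep (h : Fin t → Fin n × Bool) :
        ∑ a : Fin n, (trajP alg (nullRew n Δ) ((a, true) :: hist h) *
            ∑ b, logLR l b ((a, true) :: hist h) +
          trajP alg (nullRew n Δ) ((a, false) :: hist h) *
            ∑ b, logLR l b ((a, false) :: hist h)) =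
        trajP alg (nullRew n Δ) (hist h) * ∑ b, logLR l b (hist h) -
          trajP alg (nullRew n Δ) (hist h) * (Δ * l) := by
      rw [← mul_sub, ← mul_one (trajP alg (nullRew n Δ) (hist h)), ← (halg (hist h)).2,
        Finset.mul_sum, Finset.sum_mul]
      refine Finset.sum_congr rfl fun a _ => ?_
      rw [sum_logLR_cons, sum_logLR_cons]
      simp only [trajP, nullRew]
      simp
      ring
    simp only [hstep]
    rw [Finset.sum_sub_distrib, ih, ← Finset.sum_mul,
      sum_trajP halg (fun a => by simp [nullRew]; ring)]
    push_cast
    ring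

lemma histP_eq_trajP_mul_exp {n : ℕ} (alg : List (Fin n × Bool) → Fin n → ℝ) {Δ l : ℝ}
    (h0 : 0 < Δ) (h1 : Δ < 1) (hl : Real.exp l = (1 + Δ) / (1 - Δ)) (a : Fin n)
    (h : List (Fin n × Bool)) :
    histP n alg Δ a h = trajP alg (nullRew n Δ) h * Real.exp (logLR l a h) := by
  have hm : 1 - Δ ≠ 0 := by linarith
  have hp : 1 + Δ ≠ 0 := by linarith
  induction h with
  | nil => simp [histP, trajP, logLR]
  | cons x prev ih =>
    obtain ⟨b, r⟩ := x
    have hr : rewP n Δ a b r = nullRew n Δ b r *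
        Real.exp (if b = a then (if r then l else -l) else 0) := by
      by_cases hb : b = a <;> cases r <;>
        simp only [rewP, nullRew, hb, if_true, if_false, Bool.false_eq_true, Real.exp_neg, hl,
          Real.exp_zero] <;> field_simp <;> ring
    rw [histP, trajP, logLR, ih, hr, Real.exp_add]
    ring

/-- `L ≤ 2 + 2 (L - 1 - log L)`, written for `L = exp x`. -/
lemma exp_le_two_add (x : ℝ) : Real.exp x ≤ 2 + 2 * (Real.exp x - 1 - x) := by
  have h1 := Real.add_one_le_exp (x - 1)
  have h2 : Real.exp x = Real.exp (x - 1) * Real.exp 1 := by rw [← Real.exp_add]; ring_nf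
  have h3 := Real.add_one_le_exp (1 : ℝ)
  nlinarith [Real.exp_pos (x - 1)]

lemma succProb_le {n : ℕ} {alg : List (Fin n × Bool) → Fin n → ℝ} (halg : IsAlg n alg)
    {Δ l : ℝ} (h0 : 0 < Δ) (h1 : Δ < 1) (hl : Real.exp l = (1 + Δ) / (1 - Δ)) (t : ℕ) :
    succProb n t alg Δ ≤ (n : ℝ)⁻¹ * (2 + 2 * (t * (Δ * l))) := by
  refine mul_le_mul_of_nonneg_left ?_ (by positivity)
  set Q := trajP alg (nullRew n Δ) with hQ
  have hQ0 (h) : 0 ≤ Q h := trajP_nonneg halg (fun a r => by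
    unfold nullRew; split_ifs <;> linarith) h
  have hQ1 : ∑ h : Fin t → Fin n × Bool, Q (hist h) = 1 :=
    sum_trajP halg (fun a => by simp [nullRew]; ring) t
  have hP1 (a : Fin n) : ∑ h : Fin t → Fin n × Bool, histP n alg Δ a (hist h) = 1 := by
    simp only [histP_eq_trajP]
    exact sum_trajP halg (fun b => by simp [rewP]) t
  have hpt (h : List (Fin n × Bool)) : ∑ a, histP n alg Δ a h * alg h a ≤
      2 * Q h + 2 * (∑ a, histP n alg Δ a h - n * Q h - Q h * ∑ a, logLR l a h) := by
    have hφ (a : Fin n) : 0 ≤ Real.exp (logLR l a h) - 1 - logLR l a h := by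
      linarith [Real.add_one_le_exp (logLR l a h)]
    have hterm (a : Fin n) : histP n alg Δ a h * alg h a ≤ 2 * Q h * alg h a +
        2 * (histP n alg Δ a h - Q h - Q h * logLR l a h) := by
      rw [histP_eq_trajP_mul_exp alg h0 h1 hl a h, ← hQ]
      have ha : alg h a ≤ 1 := by
        rw [← (halg h).2]
        exact Finset.single_le_sum (fun b _ => (halg h).1 b) (Finset.mem_univ a)
      have e1 := mul_le_mul_of_nonneg_left (exp_le_two_add (logLR l a h))
        (mul_nonneg (hQ0 h) ((halg h).1 a))
      have e2 := mul_le_mul_of_nonneg_left ha (mul_nonneg (hQ0 h) (hφ a))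
      linarith
    refine (Finset.sum_le_sum fun a _ => hterm a).trans_eq ?_
    rw [Finset.sum_add_distrib, ← Finset.mul_sum, (halg h).2, ← Finset.mul_sum,
      Finset.sum_sub_distrib, Finset.sum_sub_distrib, ← Finset.mul_sum]
    simp
  rw [Finset.sum_comm]
  refine (Finset.sum_le_sum fun h _ => hpt (hist h)).trans_eq ?_
  rw [Finset.sum_add_distrib, ← Finset.mul_sum, ← Finset.mul_sum, Finset.sum_sub_distrib,
    Finset.sum_sub_distrib, ← Finset.mul_sum, hQ1, sum_trajP_mul_sum_logLR halg,
    Finset.sum_comm]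
  simp [hP1]

/-- Converse for the success probability: for every `ε ∈ (0,1)` there is `C > 0` such that
for all `n ≥ 2`, `Δ ∈ (0, 1-ε]` and horizons `t ≤ n/Δ²`, `p*_t ≤ C (1 + tΔ²)/n`. -/
theorem bandit_success_converse :
    ∀ ε : ℝ, ε ∈ Set.Ioo (0 : ℝ) 1 → ∃ C : ℝ, 0 < C ∧
      ∀ n : ℕ, 2 ≤ n → ∀ Δ : ℝ, Δ ∈ Set.Ioc (0 : ℝ) (1 - ε) →
        ∀ t : ℕ, (t : ℝ) ≤ (n : ℝ) / Δ ^ 2 →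
          pStar n t Δ ≤ C * (1 + t * Δ ^ 2) / n := by
  intro ε ⟨hε, _⟩
  refine ⟨2 + 4 / ε, by positivity, fun n hn Δ ⟨h0, hΔ⟩ t _ => ?_⟩
  have hm : 0 < 1 - Δ := by linarith
  have hratio : 0 < (1 + Δ) / (1 - Δ) := by positivity
  have hl : Real.log ((1 + Δ) / (1 - Δ)) ≤ 2 * Δ / ε := calc
    _ ≤ (1 + Δ) / (1 - Δ) - 1 := Real.log_le_sub_one_of_pos hratio
    _ = 2 * Δ / (1 - Δ) := by field_simp; ring
    _ ≤ 2 * Δ / ε := by gcongr; linarith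
  refine Real.sSup_le ?_ (by positivity)
  rintro _ ⟨alg, halg, rfl⟩
  refine (succProb_le halg h0 (by linarith) (Real.exp_log hratio) t).trans ?_
  rw [div_eq_inv_mul _ (n : ℝ)]
  refine mul_le_mul_of_nonneg_left ?_ (by positivity)
  calc 2 + 2 * (t * (Δ * Real.log ((1 + Δ) / (1 - Δ))))
      ≤ 2 + 2 * (t * (Δ * (2 * Δ / ε))) := by gcongr
    _ = 2 + 4 / ε * (t * Δ ^ 2) := by ring
    _ ≤ (2 + 4 / ε) * (1 + t * Δ ^ 2) := by
      have : 0 ≤ 4 / ε := by positivity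
      have : 0 ≤ t * Δ ^ 2 := by positivity
      linarith
end
end
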